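/- Let T be a metric tree and n ≥ 0. If f: R^{n+1} → T × R^n is a bilipschitz embedding, then the image f(R^{n+1}) is a convex subset of T × R^n isometric to R^{n+1}; in particular it has the form (geodesic line in T) × R^n. -/

import Mathlib

/-- A metric (ℝ-)tree: a geodesic metric space satisfying the four-point condition
(0-hyperbolicity), so that every geodesic triangle is a tripod. -/
structure IsRTree (T : Type) [MetricSpace T] : Prop where
  geodesic : ∀ x y : T, ∃ γ : ℝ → T, γ 0 = x ∧ γ (dist x y) = y ∧
    ∀ s ∈ Set.Icc (0 : ℝ) (dist x y), ∀ t ∈ Set.Icc (0 : ℝ) (dist x y),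
      dist (γ s) (γ t) = |s - t|
  fourPoint : ∀ x y z w : T,
    dist x y + dist z w ≤ max (dist x z + dist y w) (dist x w + dist y z)

section helpers
open MeasureTheory Set Filter Topology Metric Measure
open scoped NNReal ENNReal Convolution Pointwise
set_option linter.unusedSectionVars false
section stokes
variable {E : Type*} [NormedAddCommGroup E] [NormedSpace ℝ E] [FiniteDimensional ℝ E]
  [MeasurableSpace E] [BorelSpace E]

/-- Determinant is bounded on bounded sets of operators. -/
theorem BF.det_bound (M : ℝ) : ∃ D : ℝ, ∀ A : E →L[ℝ] E, ‖A‖ ≤ M → ‖A.det‖ ≤ D := by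
  have hc : IsCompact (closedBall (0 : E →L[ℝ] E) M) := isCompact_closedBall _ _
  obtain ⟨D, hD⟩ := hc.exists_bound_of_continuousOn
    (f := fun A : E →L[ℝ] E => A.det) ContinuousLinearMap.continuous_det.continuousOn
  exact ⟨D, fun A hA => hD A (by simpa using hA)⟩

/-- `det (t - A) > 0` for `t > ‖A‖`. -/
theorem BF.det_pos (A : E →L[ℝ] E) (t : ℝ) (ht : ‖A‖ < t) :
    0 < (t • ContinuousLinearMap.id ℝ E - A).det := by
  have ht0 : 0 < t := lt_of_le_of_lt (norm_nonneg _) ht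
  let q : ℝ → ℝ := fun s => (t • ContinuousLinearMap.id ℝ E - s • A).det
  have hq : Continuous q := ContinuousLinearMap.continuous_det.comp (by fun_prop)
  have hne : ∀ s ∈ Icc (0 : ℝ) 1, q s ≠ 0 := by
    intro s hs h0
    have h1 : LinearMap.det ((t • ContinuousLinearMap.id ℝ E - s • A : E →L[ℝ] E) : E →ₗ[ℝ] E) = 0 := h0
    have := LinearMap.bot_lt_ker_of_det_eq_zero h1
    obtain ⟨x, hx, hx0⟩ := (Submodule.ne_bot_iff _).1 this.ne'
    have hx' : t • x = s • A x := by
      have : t • x - s • A x = 0 := by simpa using hx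
      exact sub_eq_zero.1 this
    have hn : t * ‖x‖ ≤ ‖A‖ * ‖x‖ := by
      calc t * ‖x‖ = ‖t • x‖ := by rw [norm_smul, Real.norm_of_nonneg ht0.le]
        _ = ‖s • A x‖ := by rw [hx']
        _ = s * ‖A x‖ := by rw [norm_smul, Real.norm_of_nonneg hs.1]
        _ ≤ 1 * ‖A x‖ := by gcongr; exact hs.2
        _ ≤ ‖A‖ * ‖x‖ := by rw [one_mul]; exact A.le_opNorm x
    have : 0 < ‖x‖ := norm_pos_iff.2 hx0
    nlinarith
  have h0 : 0 < q 0 := by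
    have : q 0 = t ^ Module.finrank ℝ E := by
      change LinearMap.det ((t • ContinuousLinearMap.id ℝ E - (0:ℝ) • A : E →L[ℝ] E) : E →ₗ[ℝ] E) = _
      have : ((t • ContinuousLinearMap.id ℝ E - (0:ℝ) • A : E →L[ℝ] E) : E →ₗ[ℝ] E) = t • LinearMap.id := by
        ext; simp
      rw [this, LinearMap.det_smul]; simp
    rw [this]; positivity
  have h1 : 0 < q 1 := by
    by_contra hneg
    push Not at hneg
    obtain ⟨s, hs, hs0⟩ := intermediate_value_Icc' (zero_le_one) hq.continuousOn
      (show (0:ℝ) ∈ Icc (q 1) (q 0) from ⟨hneg, h0.le⟩)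
    exact hne s hs hs0
  simpa [q] using h1

variable (μ : Measure E) [μ.IsAddHaarMeasure]

theorem BF.measurable_det_fderiv (G : E → E) : Measurable fun x => (fderiv ℝ G x).det :=
  ContinuousLinearMap.continuous_det.measurable.comp (measurable_fderiv ℝ G)

theorem BF.fderiv_norm_le {F : Type*} [NormedAddCommGroup F] [NormedSpace ℝ F] {C : ℝ≥0} {G : E → F} (hG : LipschitzWith C G) (x : E) :
    ‖fderiv ℝ G x‖ ≤ C := norm_fderiv_le_of_lipschitz ℝ hG

theorem BF.integrableOn_det {C : ℝ≥0} {G : E → E} (hG : LipschitzWith C G) {s : Set E}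
    (hs : μ s ≠ ∞) (A : E →L[ℝ] E) : IntegrableOn (fun x => (A - fderiv ℝ G x).det) s μ := by
  obtain ⟨D, hD⟩ := BF.det_bound (E := E) (‖A‖ + C)
  refine Measure.integrableOn_of_bounded (M := D) hs ?_ ?_
  · exact (ContinuousLinearMap.continuous_det.measurable.comp
      ((measurable_fderiv ℝ G).const_sub A)).aestronglyMeasurable
  · refine Eventually.of_forall fun x => hD _ ?_
    exact (norm_sub_le _ _).trans (by gcongr; exact BF.fderiv_norm_le hG x)

theorem BF.integral_det_sub [Nontrivial E] {C : ℝ≥0} {G : E → E} (hG : LipschitzWith C G) {R : ℝ} (hR : 0 < R)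
    (hsupp : ∀ x, x ∉ closedBall (0 : E) R → G x = 0) {t : ℝ} (ht : C < t) :
    ∫ x in closedBall (0 : E) R, (t • ContinuousLinearMap.id ℝ E - fderiv ℝ G x).det ∂μ
      = t ^ Module.finrank ℝ E * μ.real (closedBall (0 : E) R) := by
  have ht0 : 0 < t := lt_of_le_of_lt C.2 ht
  let H : E → E := fun x => t • x - G x
  have hinj : Function.Injective H := by
    intro x y hxy
    have h1 : t • (x - y) = G x - G y := by
      have : t • x - G x = t • y - G y := hxy
      rw [smul_sub, sub_eq_sub_iff_add_eq_add]
      rw [sub_eq_sub_iff_add_eq_add] at this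
      rw [this]; abel
    have h2 : t * ‖x - y‖ ≤ C * ‖x - y‖ := by
      calc t * ‖x - y‖ = ‖t • (x - y)‖ := by rw [norm_smul, Real.norm_of_nonneg ht0.le]
        _ = ‖G x - G y‖ := by rw [h1]
        _ ≤ C * ‖x - y‖ := hG.norm_sub_le x y
    by_contra hne
    have : 0 < ‖x - y‖ := norm_pos_iff.2 (sub_ne_zero.2 hne)
    nlinarith
  have hsurj : Function.Surjective H := by
    have hap : ApproximatesLinearOn (fun x => x - t⁻¹ • G x)
        ((ContinuousLinearEquiv.refl ℝ E : E ≃L[ℝ] E) : E →L[ℝ] E) univ (Real.toNNReal (t⁻¹ * C)) := by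
      rw [ApproximatesLinearOn.approximatesLinearOn_iff_lipschitzOnWith]
      apply LipschitzWith.lipschitzOnWith
      apply LipschitzWith.of_dist_le_mul
      intro x y
      rw [Real.coe_toNNReal _ (by positivity), dist_eq_norm, dist_eq_norm]
      have : ((fun x => x - t⁻¹ • G x) - ⇑((ContinuousLinearEquiv.refl ℝ E : E ≃L[ℝ] E) : E →L[ℝ] E)) x
        - ((fun x => x - t⁻¹ • G x) - ⇑((ContinuousLinearEquiv.refl ℝ E : E ≃L[ℝ] E) : E →L[ℝ] E)) y
        = -(t⁻¹ • (G x - G y)) := by simp [smul_sub]; abel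
      rw [this, norm_neg, norm_smul, Real.norm_of_nonneg (by positivity), mul_assoc]
      gcongr
      exact hG.norm_sub_le x y
    have hs := hap.surjective (Or.inr (by
      have : ‖((ContinuousLinearEquiv.refl ℝ E).symm : E →L[ℝ] E)‖₊ = 1 := by
        ext; exact ContinuousLinearMap.norm_id
      rw [this, inv_one, ← NNReal.coe_lt_coe, Real.coe_toNNReal _ (by positivity), NNReal.coe_one,
        inv_mul_lt_iff₀ ht0]; simpa using ht))
    intro y
    obtain ⟨x, hx⟩ := hs (t⁻¹ • y)
    refine ⟨x, ?_⟩
    have := congrArg (fun z => t • z) hx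
    simpa [smul_sub, smul_smul, ht0.ne', H] using this
  have himg : H '' closedBall (0 : E) R = t • closedBall (0 : E) R := by
    ext y
    rw [mem_smul_set_iff_inv_smul_mem₀ ht0.ne']
    constructor
    · rintro ⟨x, hx, rfl⟩
      by_contra hn
      have h2 : H (t⁻¹ • H x) = H x := by
        simp only [H] at hn ⊢
        rw [hsupp _ hn]; simp [smul_smul, ht0.ne']
      rw [hinj h2] at hn
      exact hn hx
    · intro hy
      obtain ⟨x, rfl⟩ := hsurj y
      refine ⟨x, ?_, rfl⟩
      by_contra hn
      simp only [H, hsupp x hn] at hy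
      simp [smul_smul, ht0.ne'] at hy
      exact hn (by simpa using hy)
  let D : Set E := {x | DifferentiableAt ℝ G x}
  have hDm : MeasurableSet D := measurableSet_of_differentiableAt ℝ G
  have hDae : ∀ᵐ x ∂μ, x ∈ D := hG.ae_differentiableAt
  set B := closedBall (0 : E) R with hB
  have hBm : MeasurableSet B := measurableSet_closedBall
  have hH' : ∀ x ∈ D, HasFDerivAt H (t • ContinuousLinearMap.id ℝ E - fderiv ℝ G x) x := by
    intro x hx
    exact ((hasFDerivAt_id x).const_smul t).sub (DifferentiableAt.hasFDerivAt hx)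
  have hHl : LipschitzWith (Real.toNNReal t + C) H := by
    refine LipschitzWith.sub ?_ hG
    apply LipschitzWith.of_dist_le_mul
    intro x y
    rw [dist_smul₀, Real.norm_of_nonneg ht0.le, Real.coe_toNNReal _ ht0.le]
  have hnull : μ (H '' (B \ D)) = 0 := by
    have h0 : μ (B \ D) = 0 := by
      refine measure_mono_null (fun x hx => hx.2) (ae_iff.1 hDae)
    have hd : 0 ≤ (Module.finrank ℝ E : ℝ) := by positivity
    have hac : μ ≪ μH[Module.finrank ℝ E] := by
      exact Measure.absolutelyContinuous_isAddHaarMeasure _ _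
    have hac' : (μH[Module.finrank ℝ E] : Measure E) ≪ μ := by
      exact Measure.absolutelyContinuous_isAddHaarMeasure _ _
    apply hac
    refine le_antisymm ((hHl.hausdorffMeasure_image_le hd (B \ D)).trans ?_) bot_le
    rw [hac' h0]; simp
  have hkey := lintegral_abs_det_fderiv_eq_addHaar_image μ (hBm.inter hDm)
    (fun x hx => (hH' x hx.2).hasFDerivWithinAt) (hinj.injOn)
  have hvol : μ (H '' (B ∩ D)) = ENNReal.ofReal (t ^ Module.finrank ℝ E) * μ B := by
    have h1 : μ (H '' (B ∩ D)) = μ (H '' B) := by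
      apply le_antisymm (measure_mono (image_mono inter_subset_left))
      have : H '' B = H '' (B ∩ D) ∪ H '' (B \ D) := by rw [← image_union, inter_union_sdiff]
      rw [this]
      refine (measure_union_le _ _).trans ?_
      rw [hnull, add_zero]
    rw [h1, himg, Measure.addHaar_smul, abs_of_nonneg (by positivity)]
  have hBD : μ.restrict (B ∩ D) = μ.restrict B := by
    apply Measure.restrict_congr_set
    filter_upwards [hDae] with x hx
    simp only [eq_iff_iff]
    exact ⟨fun h => h.1, fun h => ⟨h, hx⟩⟩
  rw [hBD, hvol] at hkey
  have hpos : ∀ x, 0 < (t • ContinuousLinearMap.id ℝ E - fderiv ℝ G x).det := fun x =>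
    BF.det_pos _ _ (lt_of_le_of_lt (BF.fderiv_norm_le hG x) ht)
  rw [integral_eq_lintegral_of_nonneg_ae (Eventually.of_forall fun x => (hpos x).le)
    (BF.integrableOn_det μ hG (measure_closedBall_lt_top.ne) _).aestronglyMeasurable]
  simp_rw [abs_of_pos (hpos _)] at hkey
  rw [hkey, ENNReal.toReal_mul, ENNReal.toReal_ofReal (by positivity)]
  rfl

/-- Stokes: the Jacobian determinant of a compactly supported Lipschitz map has zero integral. -/
theorem BF.integral_det_eq_zero [Nontrivial E] {C : ℝ≥0} {G : E → E} (hG : LipschitzWith C G)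
    (hc : HasCompactSupport G) : ∫ x, (fderiv ℝ G x).det ∂μ = 0 := by
  obtain ⟨R, hR, hRs⟩ : ∃ R > 0, tsupport G ⊆ closedBall (0 : E) R := by
    obtain ⟨R, hR⟩ := hc.isCompact.isBounded.subset_closedBall (0 : E)
    exact ⟨max R 1, by positivity, hR.trans (closedBall_subset_closedBall (le_max_left _ _))⟩
  have hsupp : ∀ x, x ∉ closedBall (0 : E) R → G x = 0 := fun x hx =>
    image_eq_zero_of_notMem_tsupport fun h => hx (hRs h)
  set N := Module.finrank ℝ E with hN
  have hN0 : N ≠ 0 := Module.finrank_pos.ne'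
  let v : ℕ → ℝ := fun j => C + 1 + j
  have hv : Set.InjOn v (Finset.range (N + 1)) := by
    intro i _ j _ h
    simpa [v] using h
  let c : ℕ → ℝ := fun j => (Lagrange.basis (Finset.range (N + 1)) v j).eval 0
  have hinterp : ∀ p : Polynomial ℝ, p.degree < (N + 1 : ℕ) →
      p.eval 0 = ∑ j ∈ Finset.range (N + 1), p.eval (v j) * c j := by
    intro p hp
    conv_lhs => rw [Lagrange.eq_interpolate (f := p) hv (by simpa using hp)]
    rw [Lagrange.interpolate_apply, Polynomial.eval_finsetSum]
    simp [c]
  have hA : ∀ A : E →L[ℝ] E, (-A).det = ∑ j ∈ Finset.range (N + 1),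
      (v j • ContinuousLinearMap.id ℝ E - A).det * c j := by
    intro A
    have h1 : ∀ t : ℝ, (LinearMap.charpoly (A : E →ₗ[ℝ] E)).eval t
        = (t • ContinuousLinearMap.id ℝ E - A).det := by
      intro t
      rw [LinearMap.eval_charpoly]
      change _ = LinearMap.det _
      congr 1
    have h2 := hinterp (LinearMap.charpoly (A : E →ₗ[ℝ] E)) (by
      rw [Polynomial.degree_eq_natDegree (LinearMap.charpoly_monic _).ne_zero,
        LinearMap.charpoly_natDegree]
      exact_mod_cast Nat.lt_succ_self _)
    simp_rw [h1] at h2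
    simpa using h2
  have hneg : ∀ A : E →L[ℝ] E, A.det = (-1) ^ N * (-A).det := by
    intro A
    have : LinearMap.det ((-A : E →L[ℝ] E) : E →ₗ[ℝ] E) = (-1) ^ N * LinearMap.det (A : E →ₗ[ℝ] E) := by
      rw [hN, ← LinearMap.det_smul]; congr 1; ext; simp
    change LinearMap.det _ = _ * LinearMap.det _
    rw [this, ← mul_assoc, ← mul_pow]; simp
  have hB : ∫ x, (fderiv ℝ G x).det ∂μ = ∫ x in closedBall (0 : E) R, (fderiv ℝ G x).det ∂μ := by
    symm
    apply setIntegral_eq_integral_of_forall_compl_eq_zero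
    intro x hx
    have : fderiv ℝ G x = 0 := by
      have := support_fderiv_subset ℝ (f := G)
      by_contra h
      exact hx (hRs (this h))
    rw [this]
    change LinearMap.det _ = _
    simp
  rw [hB]
  simp_rw [hneg (fderiv ℝ G _), hA]
  rw [integral_const_mul, integral_finsetSum]
  · have h3 : ∀ j, ∫ x in closedBall (0 : E) R,
        (v j • ContinuousLinearMap.id ℝ E - fderiv ℝ G x).det * c j ∂μ
        = (v j ^ N * c j) * μ.real (closedBall (0 : E) R) := by
      intro j
      rw [integral_mul_const, BF.integral_det_sub μ hG hR hsupp
        (by simp only [v]; have : (0:ℝ) ≤ j := by positivity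
            linarith)]
      ring
    simp_rw [h3]
    rw [← Finset.sum_mul]
    have h4 := hinterp (Polynomial.X ^ N) (by rw [Polynomial.degree_X_pow]; exact_mod_cast Nat.lt_succ_self _)
    simp [hN0] at h4
    rw [← h4]; simp
  · intro j _
    exact (BF.integrableOn_det μ hG (measure_closedBall_lt_top.ne) _).mul_const _
end stokes

section rel
variable {E : Type*} [NormedAddCommGroup E] [NormedSpace ℝ E] [FiniteDimensional ℝ E]
  [MeasurableSpace E] [BorelSpace E]
variable (μ : Measure E) [μ.IsAddHaarMeasure]

theorem BF.null_image {K : ℝ≥0} {g : E → E} {s : Set E} (hg : LipschitzOnWith K g s)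
    (hs : μ s = 0) : μ (g '' s) = 0 := by
  have hd : 0 ≤ (Module.finrank ℝ E : ℝ) := by positivity
  have hac : μ ≪ μH[Module.finrank ℝ E] := Measure.absolutelyContinuous_isAddHaarMeasure _ _
  have hac' : (μH[Module.finrank ℝ E] : Measure E) ≪ μ :=
    Measure.absolutelyContinuous_isAddHaarMeasure _ _
  apply hac
  refine le_antisymm ((hg.hausdorffMeasure_image_le hd).trans ?_) bot_le
  rw [hac' hs]; simp

theorem BF.lip_cutoff {F : Type*} [NormedAddCommGroup F] [NormedSpace ℝ F] {z : E → ℝ} {G : E → F} {C D : ℝ≥0} (hz : LipschitzWith C z)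
    (hzc : HasCompactSupport z) (hG : LipschitzWith D G) :
    ∃ K : ℝ≥0, LipschitzWith K (fun x => z x • G x) := by
  obtain ⟨M, hM⟩ := hzc.exists_bound_of_continuous hz.continuous
  obtain ⟨M', hM'⟩ := hzc.isCompact.exists_bound_of_continuousOn (f := G) hG.continuous.continuousOn
  have hM0 : 0 ≤ M := (norm_nonneg _).trans (hM 0)
  have key : ∀ x y, x ∈ tsupport z →
      ‖z x • G x - z y • G y‖ ≤ (M * D + C * max M' 0) * ‖x - y‖ := by
    intro x y hx
    have e : z x • G x - z y • G y = z y • (G x - G y) + (z x - z y) • G x := by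
      rw [smul_sub, sub_smul]; abel
    rw [e]
    refine (norm_add_le _ _).trans ?_
    rw [norm_smul, norm_smul]
    have h1 : ‖z y‖ * ‖G x - G y‖ ≤ M * (D * ‖x - y‖) := by
      gcongr
      · exact hM y
      · exact hG.norm_sub_le x y
    have h2 : ‖z x - z y‖ * ‖G x‖ ≤ (C * ‖x - y‖) * max M' 0 := by
      gcongr
      · exact hz.norm_sub_le x y
      · exact (hM' x hx).trans (le_max_left _ _)
    linarith
  have hK0 : 0 ≤ M * D + C * max M' 0 := by positivity
  refine ⟨Real.toNNReal (M * D + C * max M' 0), LipschitzWith.of_dist_le_mul fun x y => ?_⟩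
  rw [Real.coe_toNNReal _ hK0, dist_eq_norm, dist_eq_norm]
  by_cases hx : x ∈ tsupport z
  · exact key x y hx
  by_cases hy : y ∈ tsupport z
  · have := key y x hy
    rwa [norm_sub_rev, norm_sub_rev x y]
  rw [image_eq_zero_of_notMem_tsupport hx, image_eq_zero_of_notMem_tsupport hy]
  simp only [zero_smul, sub_zero, norm_zero]
  positivity

theorem BF.det_zero [Nontrivial E] : (0 : E →L[ℝ] E).det = 0 := by
  change LinearMap.det _ = _
  simp

theorem BF.integrable_det [Nontrivial E] {C : ℝ≥0} {G : E → E} (hG : LipschitzWith C G)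
    (hc : HasCompactSupport G) : Integrable (fun x => (fderiv ℝ G x).det) μ := by
  obtain ⟨D, hD⟩ := BF.det_bound (E := E) C
  have h1 : IntegrableOn (fun x => (fderiv ℝ G x).det) (tsupport G) μ := by
    refine Measure.integrableOn_of_bounded (M := D) hc.isCompact.measure_lt_top.ne ?_ ?_
    · exact (BF.measurable_det_fderiv G).aestronglyMeasurable
    · exact Eventually.of_forall fun x => hD _ (BF.fderiv_norm_le hG x)
  refine (integrableOn_iff_integrable_of_support_subset ?_).1 h1
  intro x hx
  by_contra h
  apply hx
  have : fderiv ℝ G x = 0 := by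
    by_contra h'
    exact h (support_fderiv_subset ℝ (f := G) h')
  simp only [this, BF.det_zero]

/-- Relative Stokes. -/
theorem BF.integral_det_sub_eq_zero [Nontrivial E] {C D : ℝ≥0} {F G : E → E} (hF : LipschitzWith C F)
    (hG : LipschitzWith D G) (hc : HasCompactSupport (fun x => G x - F x)) :
    ∫ x, ((fderiv ℝ G x).det - (fderiv ℝ F x).det) ∂μ = 0 := by
  obtain ⟨R, hR, hRs⟩ : ∃ R > 0, tsupport (fun x => G x - F x) ⊆ ball (0 : E) R := by
    obtain ⟨R, hR⟩ := hc.isCompact.isBounded.subset_ball (0 : E)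
    exact ⟨max R 1, by positivity, hR.trans (ball_subset_ball (le_max_left _ _))⟩
  let z : ContDiffBump (0 : E) := ⟨R, R + 1, hR, by linarith⟩
  have hzc : HasCompactSupport z := z.hasCompactSupport
  obtain ⟨K, hz⟩ := ContDiff.lipschitzWith_of_hasCompactSupport (𝕂 := ℝ) hzc (z.contDiff (n := 1)) one_ne_zero
  obtain ⟨K1, h1⟩ := BF.lip_cutoff hz hzc hF
  obtain ⟨K2, h2⟩ := BF.lip_cutoff hz hzc hG
  have c1 : HasCompactSupport (fun x => z x • F x) := hzc.smul_right
  have c2 : HasCompactSupport (fun x => z x • G x) := hzc.smul_right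
  have heq : ∀ x, (fderiv ℝ G x).det - (fderiv ℝ F x).det
      = (fderiv ℝ (fun x => z x • G x) x).det - (fderiv ℝ (fun x => z x • F x) x).det := by
    intro x
    by_cases hx : x ∈ ball (0 : E) R
    · have hev : ∀ᶠ y in 𝓝 x, z y = 1 := by
        filter_upwards [isOpen_ball.mem_nhds hx] with y hy
        exact z.one_of_mem_closedBall (ball_subset_closedBall hy)
      have e1 : (fun x => z x • G x) =ᶠ[𝓝 x] G := by
        filter_upwards [hev] with y hy; simp [hy]
      have e2 : (fun x => z x • F x) =ᶠ[𝓝 x] F := by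
        filter_upwards [hev] with y hy; simp [hy]
      rw [e1.fderiv_eq, e2.fderiv_eq]
    · have hx' : x ∉ tsupport (fun x => G x - F x) := fun h => hx (hRs h)
      have hev : G =ᶠ[𝓝 x] F := by
        rw [notMem_tsupport_iff_eventuallyEq] at hx'
        filter_upwards [hx'] with y hy
        exact sub_eq_zero.1 hy
      have e1 : (fun x => z x • G x) =ᶠ[𝓝 x] (fun x => z x • F x) := by
        filter_upwards [hev] with y hy; simp [hy]
      rw [e1.fderiv_eq, hev.fderiv_eq]; simp
  simp_rw [heq]
  rw [integral_sub (BF.integrable_det μ h2 c2) (BF.integrable_det μ h1 c1),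
    BF.integral_det_eq_zero μ h1 c1, BF.integral_det_eq_zero μ h2 c2, sub_zero]

theorem BF.conv_const {σ : E → ℝ} (hσ : LocallyIntegrable σ μ) (φ : ContDiffBump (0 : E)) (x y : E)
    (h : ∀ Ψ : E → ℝ, ContDiff ℝ 1 Ψ → HasCompactSupport Ψ →
      (∃ z ∈ segment ℝ x y, ∀ t, t ∉ ball z φ.rOut → Ψ t = 0) →
      ∫ t, σ t * fderiv ℝ Ψ t (y - x) ∂μ = 0) :
    (φ.normed μ ⋆[ContinuousLinearMap.lsmul ℝ ℝ, μ] σ) x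
      = (φ.normed μ ⋆[ContinuousLinearMap.lsmul ℝ ℝ, μ] σ) y := by
  set g := φ.normed μ with hg
  have hgc : HasCompactSupport g := φ.hasCompactSupport_normed
  have hgs : ContDiff ℝ 1 g := φ.contDiff_normed
  have hd : ∀ z, HasFDerivAt (g ⋆[ContinuousLinearMap.lsmul ℝ ℝ, μ] σ)
      ((fderiv ℝ g ⋆[(ContinuousLinearMap.lsmul ℝ ℝ).precompL E, μ] σ) z) z := fun z =>
    hgc.hasFDerivAt_convolution_left _ hgs hσ z
  have hzero : ∀ z ∈ segment ℝ x y,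
      ((fderiv ℝ g ⋆[(ContinuousLinearMap.lsmul ℝ ℝ).precompL E, μ] σ) z) (y - x) = 0 := by
    intro z hz
    have hex : ConvolutionExistsAt (fderiv ℝ g) σ z ((ContinuousLinearMap.lsmul ℝ ℝ).precompL E) μ :=
      (hgc.fderiv ℝ).convolutionExists_left _ (hgs.continuous_fderiv one_ne_zero) hσ z
    rw [convolution_eq_swap]
    rw [ContinuousLinearMap.integral_apply]
    · have h3 := h (fun t => g (z - t)) (hgs.comp (contDiff_const.sub contDiff_id))
        (hgc.comp_homeomorph (Homeomorph.subLeft z)) ⟨z, hz, fun t ht => by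
          have : z - t ∉ Function.support g := by
            rw [hg, φ.support_normed_eq]
            intro h'
            apply ht
            simpa [dist_eq_norm, norm_sub_rev] using h'
          simpa using this⟩
      have h4 : ∀ t, fderiv ℝ (fun t => g (z - t)) t (y - x) = - fderiv ℝ g (z - t) (y - x) := by
        intro t
        have h5 : HasFDerivAt (fun t => g (z - t)) ((fderiv ℝ g (z - t)).comp (-ContinuousLinearMap.id ℝ E)) t :=
          ((hgs.differentiable one_ne_zero) (z - t)).hasFDerivAt.comp t ((hasFDerivAt_id t).const_sub z)
        rw [h5.fderiv]; simp
      simp_rw [h4] at h3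
      simp only [mul_neg, integral_neg, neg_eq_zero] at h3
      rw [← h3]
      congr 1
      ext t
      simp [mul_comm, ContinuousLinearMap.precompL_apply]
      ring
    · exact hex.integrable_swap
  let c : ℝ → ℝ := fun τ => (g ⋆[ContinuousLinearMap.lsmul ℝ ℝ, μ] σ) (x + τ • (y - x))
  have hc : ∀ τ ∈ Icc (0 : ℝ) 1, HasDerivAt c 0 τ := by
    intro τ hτ
    have hl : HasDerivAt (fun τ : ℝ => x + τ • (y - x)) (y - x) τ := by
      simpa using ((hasDerivAt_id τ).smul_const (y - x)).const_add x
    have := (hd (x + τ • (y - x))).comp_hasDerivAt τ hl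
    rw [hzero _ (by rw [segment_eq_image']; exact ⟨τ, hτ, rfl⟩)] at this
    exact this
  have := constant_of_has_deriv_right_zero (f := c) (a := 0) (b := 1)
    (fun τ hτ => (hc τ hτ).continuousAt.continuousWithinAt)
    (fun τ hτ => (hc τ ⟨hτ.1, hτ.2.le⟩).hasDerivWithinAt) 1 ⟨zero_le_one, le_rfl⟩
  simp only [c] at this
  simpa using this.symm

/-- standard shrinking bump sequence -/
noncomputable def BF.bump (k : ℕ) : ContDiffBump (0 : E) :=
  ⟨1 / (k + 2), 2 / (k + 2), by positivity, by gcongr; norm_num⟩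

theorem BF.bump_tendsto : Tendsto (fun k => (BF.bump (E := E) k).rOut) atTop (𝓝 0) := by
  change Tendsto (fun k : ℕ => (2 : ℝ) / (k + 2)) atTop (𝓝 0)
  apply Tendsto.div_atTop tendsto_const_nhds
  exact tendsto_atTop_add_const_right _ _ tendsto_natCast_atTop_atTop

theorem BF.ae_conv {σ : E → ℝ} (hσ : LocallyIntegrable σ μ) : ∀ᵐ x ∂μ,
    Tendsto (fun k => ((BF.bump k).normed μ ⋆[ContinuousLinearMap.lsmul ℝ ℝ, μ] σ) x) atTop (𝓝 (σ x)) :=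
  ContDiffBump.ae_convolution_tendsto_right_of_locallyIntegrable (K := 2) BF.bump_tendsto
    (Eventually.of_forall fun k => by
      change (2 : ℝ) / (k + 2) ≤ 2 * (1 / (k + 2)); apply le_of_eq; ring) hσ

theorem BF.lip_const {C : ℝ≥0} {g : E → ℝ} (hg : LipschitzWith C g)
    (h0 : ∀ᵐ x ∂μ, fderiv ℝ g x = 0) (x y : E) : g x = g y := by
  have h1 := ContDiffBump.convolution_tendsto_right_of_continuous (μ := μ) (BF.bump_tendsto (E := E)) hg.continuous x
  have h2 := ContDiffBump.convolution_tendsto_right_of_continuous (μ := μ) (BF.bump_tendsto (E := E)) hg.continuous y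
  refine tendsto_nhds_unique h1 (h2.congr fun k => ?_)
  refine (BF.conv_const μ (hg.continuous.locallyIntegrable) _ x y ?_).symm
  intro Ψ hΨ hΨc _
  obtain ⟨D, hD⟩ := ContDiff.lipschitzWith_of_hasCompactSupport (𝕂 := ℝ) hΨc hΨ one_ne_zero
  have h3 := hg.integral_lineDeriv_mul_eq (μ := μ) hD hΨc (-(y - x))
  have h4 : ∫ t, lineDeriv ℝ g t (-(y - x)) * Ψ t ∂μ = 0 := by
    apply integral_eq_zero_of_ae
    filter_upwards [h0, hg.ae_differentiableAt] with t ht ht'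
    rw [ht'.lineDeriv_eq_fderiv, ht]; simp
  rw [h4] at h3
  rw [h3]
  congr 1; ext t
  rw [((hΨ.differentiable one_ne_zero) t).lineDeriv_eq_fderiv, neg_neg, mul_comm]
end rel

section tree
variable {T : Type} [MetricSpace T]

/-- Gromov product `(t|d)_c`: coordinate of the projection of `t` to `[c,d]`. -/
noncomputable def BF.th (c d t : T) : ℝ := (dist c t + dist c d - dist t d) / 2

/-- Twice the distance from `t` to `[c,d]`. -/
noncomputable def BF.ex (c d t : T) : ℝ := dist c t + dist t d - dist c d

theorem BF.th_nonneg (c d t : T) : 0 ≤ BF.th c d t := by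
  have := dist_triangle t c d
  rw [dist_comm t c] at this
  unfold BF.th; linarith

theorem BF.th_le (c d t : T) : BF.th c d t ≤ dist c d := by
  have := dist_triangle c d t
  rw [dist_comm d t] at this
  unfold BF.th; linarith

theorem BF.th_lip (c d : T) : LipschitzWith 1 (BF.th c d) := by
  apply LipschitzWith.of_dist_le_mul
  intro s t
  rw [Real.dist_eq, NNReal.coe_one, one_mul, abs_le]
  have h1 := dist_triangle c s t
  have h2 := dist_triangle c t s
  have h3 := dist_triangle s t d
  have h4 := dist_triangle t s d
  rw [dist_comm t s] at h2 h4
  unfold BF.th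
  constructor <;> linarith

theorem BF.ex_nonneg (c d t : T) : 0 ≤ BF.ex c d t := by
  have := dist_triangle c t d
  unfold BF.ex; linarith

theorem BF.ex_continuous (c d : T) : Continuous (BF.ex c d) := by
  unfold BF.ex; fun_prop

theorem BF.ex_lip (c d : T) : LipschitzWith 2 (BF.ex c d) := by
  apply LipschitzWith.of_dist_le_mul
  intro s t
  rw [Real.dist_eq, abs_le]
  have h1 := dist_triangle c s t
  have h2 := dist_triangle c t s
  have h3 := dist_triangle s t d
  have h4 := dist_triangle t s d
  rw [dist_comm t s] at h2 h4
  unfold BF.ex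
  constructor <;> simp <;> linarith

theorem BF.th_const (hT : IsRTree T) {c d t t' : T} (h : dist t t' < BF.ex c d t / 2) :
    BF.th c d t' = BF.th c d t := by
  have f1 := hT.fourPoint t t' c d
  have f2 := hT.fourPoint t c t' d
  have f3 := hT.fourPoint t d t' c
  have h1 := dist_triangle c t' t
  have h2 := dist_triangle t t' d
  have a1 := dist_comm t c
  have a2 := dist_comm t' c
  have a3 := dist_comm t' t
  have a4 := dist_comm d c
  have a5 := dist_comm t d
  have a6 := dist_comm t' d
  have a7 := @dist_nonneg _ _ t t'
  unfold BF.ex at h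
  unfold BF.th
  rw [le_max_iff] at f1 f2 f3
  rcases f2 with f2 | f2 <;> rcases f3 with f3 | f3 <;> rcases f1 with f1 | f1 <;> linarith

theorem BF.th_eq_dist {c d s : T} (hs : BF.ex c d s = 0) : BF.th c d s = dist c s := by
  unfold BF.ex at hs; unfold BF.th; linarith

theorem BF.th_isom (hT : IsRTree T) {c d s t : T} (hs : BF.ex c d s = 0) (ht : BF.ex c d t = 0) :
    |BF.th c d s - BF.th c d t| = dist s t := by
  apply le_antisymm
  · have := (BF.th_lip c d).dist_le_mul s t
    simpa [Real.dist_eq] using this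
  have f1 := hT.fourPoint s t c d
  rw [BF.th_eq_dist hs, BF.th_eq_dist ht]
  unfold BF.ex at hs ht
  have a1 := dist_comm s c
  have a2 := dist_comm t c
  rw [le_max_iff] at f1
  rcases f1 with f1 | f1
  · exact le_trans (by linarith) (le_abs_self _)
  · exact le_trans (by linarith) (neg_le_abs _)

theorem BF.range_convex (hT : IsRTree T) {X : Type*} [TopologicalSpace X] [PreconnectedSpace X]
    {u : X → T} (hu : Continuous u) {c d p : T} (hc : c ∈ range u) (hd : d ∈ range u)
    (hp : BF.ex c d p = 0) : p ∈ range u := by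
  by_contra hn
  have hpc : dist c p ≠ 0 := fun h => hn ((dist_eq_zero.1 h) ▸ hc)
  have hpd : dist p d ≠ 0 := fun h => hn ((dist_eq_zero.1 h) ▸ hd)
  have hth : Continuous fun x => BF.th c d (u x) := (BF.th_lip c d).continuous.comp hu
  let A : Set X := {x | BF.th c d (u x) ≤ BF.th c d p}
  have hcl : IsClosed A := isClosed_le hth continuous_const
  have hop : IsOpen A := by
    rw [isOpen_iff_mem_nhds]
    intro x hx
    rcases lt_or_eq_of_le (show BF.th c d (u x) ≤ BF.th c d p from hx) with h | h
    · filter_upwards [(isOpen_lt hth continuous_const).mem_nhds h] with y hy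
      exact le_of_lt hy
    · have hex : 0 < BF.ex c d (u x) := by
        rcases (BF.ex_nonneg c d (u x)).lt_or_eq with h' | h'
        · exact h'
        · exfalso
          have := BF.th_isom hT h'.symm hp
          rw [h, sub_self, abs_zero] at this
          exact hn ⟨x, dist_eq_zero.1 this.symm⟩
      have : ∀ᶠ y in 𝓝 x, dist (u x) (u y) < BF.ex c d (u x) / 2 := by
        have h2 : Continuous fun y => dist (u x) (u y) := by fun_prop
        apply (isOpen_lt h2 continuous_const).mem_nhds
        simp only [mem_ofPred_eq, dist_self]; linarith
      filter_upwards [this] with y hy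
      change BF.th c d (u y) ≤ BF.th c d p
      rw [BF.th_const hT hy]; exact hx
  rcases isClopen_iff.1 ⟨hcl, hop⟩ with h | h
  · obtain ⟨x, rfl⟩ := hc
    have : x ∈ A := by
      change BF.th _ _ _ ≤ _
      rw [BF.th_eq_dist (c := u x) (s := u x) (by simp [BF.ex])]
      simpa using BF.th_nonneg _ _ _
    rw [h] at this; exact this
  · obtain ⟨y, rfl⟩ := hd
    have : y ∈ A := by rw [h]; trivial
    change BF.th _ _ _ ≤ _ at this
    rw [BF.th_eq_dist (d := u y) (s := u y) (by simp [BF.ex]), BF.th_eq_dist hp] at this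
    unfold BF.ex at hp
    have h3 : 0 ≤ dist p (u y) := dist_nonneg
    exact hpd (by linarith)

theorem BF.opposite (hT : IsRTree T) {c d p t t' : T} (hp : BF.ex c d p = 0)
    (ht : 0 < BF.th p d t) (ht' : 0 < BF.th p c t') : dist t' t = dist t' p + dist p t := by
  have f1 := hT.fourPoint c d t' p
  have f2 := hT.fourPoint t' d t p
  have a1 := dist_comm t p
  have a2 := dist_comm t' p
  have a3 := dist_comm c p
  have a4 := dist_comm d p
  have a5 := dist_comm t d
  have a6 := dist_comm t' d
  have a7 := dist_comm t' c
  have a8 := dist_triangle t' p t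
  unfold BF.ex at hp
  unfold BF.th at ht ht'
  rw [le_max_iff] at f1 f2
  rcases f1 with f1 | f1 <;> rcases f2 with f2 | f2 <;> linarith

/-- Long isometric paths through `p` in the image. -/
theorem BF.path (hT : IsRTree T) {t t' p : T} (h : dist t' t = dist t' p + dist p t)
    {k : ℝ} (h1 : k ≤ dist t' p) (h2 : k ≤ dist p t) :
    ∃ g : ℝ → T, g 0 = p ∧ (∀ r ∈ Icc (-k) k, BF.ex t' t (g r) = 0) ∧
      ∀ r ∈ Icc (-k) k, ∀ s ∈ Icc (-k) k, dist (g r) (g s) = |r - s| := by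
  obtain ⟨γ, g0, g1, gi⟩ := hT.geodesic t' t
  have hn1 : 0 ≤ dist t' p := dist_nonneg
  have hn2 : 0 ≤ dist p t := dist_nonneg
  have hex : ∀ s ∈ Icc (0:ℝ) (dist t' t), BF.ex t' t (γ s) = 0 := by
    intro s hs
    have e1 := gi 0 ⟨le_rfl, dist_nonneg⟩ s hs
    have e2 := gi s hs (dist t' t) ⟨dist_nonneg, le_rfl⟩
    rw [g0, zero_sub, abs_neg, abs_of_nonneg hs.1] at e1
    rw [g1, abs_sub_comm, abs_of_nonneg (by linarith [hs.2])] at e2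
    unfold BF.ex; linarith
  refine ⟨fun r => γ (r + dist t' p), ?_, ?_, ?_⟩
  · have hm : (dist t' p) ∈ Icc (0:ℝ) (dist t' t) := ⟨hn1, by linarith⟩
    have hpe : BF.ex t' t p = 0 := by unfold BF.ex; linarith
    have := BF.th_isom hT (hex _ hm) hpe
    rw [BF.th_eq_dist (hex _ hm), BF.th_eq_dist hpe] at this
    have e1 := gi 0 ⟨le_rfl, dist_nonneg⟩ _ hm
    rw [g0, zero_sub, abs_neg, abs_of_nonneg hn1] at e1
    rw [e1, sub_self, abs_zero] at this
    simpa using (dist_eq_zero.1 this.symm)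
  · intro r hr
    exact hex _ ⟨by linarith [hr.1], by linarith [hr.2]⟩
  · intro r hr s hs
    rw [gi _ ⟨by linarith [hr.1], by linarith [hr.2]⟩ _ ⟨by linarith [hs.1], by linarith [hs.2]⟩]
    congr 1; ring

theorem BF.real_tree : IsRTree ℝ where
  geodesic x y := by
    rcases le_total x y with h | h
    · refine ⟨fun s => x + s, by simp, ?_, ?_⟩
      · simp only [Real.dist_eq]; rw [abs_sub_comm, abs_of_nonneg (by linarith)]; ring
      · intro s _ t _; rw [Real.dist_eq]; congr 1; ring
    · refine ⟨fun s => x - s, by simp, ?_, ?_⟩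
      · simp only [Real.dist_eq]; rw [abs_of_nonneg (by linarith)]; ring
      · intro s _ t _; rw [Real.dist_eq, abs_sub_comm s t]; congr 1; ring
  fourPoint x y z w := by
    simp only [Real.dist_eq, le_max_iff]
    by_contra! hcon
    obtain ⟨h1, h2⟩ := hcon
    rcases abs_cases (x - y) with ⟨e1, _⟩ | ⟨e1, _⟩ <;> rcases abs_cases (z - w) with ⟨e2, _⟩ | ⟨e2, _⟩ <;>
    rw [e1, e2] at h1 h2 <;>
    linarith [le_abs_self (x - z), neg_le_abs (x - z), le_abs_self (y - w), neg_le_abs (y - w),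
      le_abs_self (x - w), neg_le_abs (x - w), le_abs_self (y - z), neg_le_abs (y - z)]
end tree

section sigma
variable {E : Type*} [NormedAddCommGroup E] [NormedSpace ℝ E] [FiniteDimensional ℝ E]
  [MeasurableSpace E] [BorelSpace E]
variable (μ : Measure E) [μ.IsAddHaarMeasure]

/-- Signed multiplicity function of the Lipschitz image of a set K. -/
theorem BF.sigma {C A : ℝ≥0} {F : E → E} (hF : LipschitzWith C F) {K : Set E}
    (hK : MeasurableSet K) (hA : ∀ x ∈ K, ∀ y ∈ K, dist x y ≤ A * dist (F x) (F y)) :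
    ∃ σ : E → ℝ, LocallyIntegrable σ μ ∧ (∀ z, z ∉ F '' K → σ z = 0) ∧
      (∀ g : E → ℝ, ∫ z, σ z * g z ∂μ = ∫ x in K, (fderiv ℝ F x).det * g (F x) ∂μ) ∧
      (σ =ᵐ[μ] 0 → μ K = 0) := by
  set K0 : Set E := K ∩ {x | DifferentiableAt ℝ F x} with hK0
  have hK0m : MeasurableSet K0 := hK.inter (measurableSet_of_differentiableAt ℝ F)
  have hae : ∀ᵐ x ∂μ, DifferentiableAt ℝ F x := hF.ae_differentiableAt
  have hKae : K0 =ᵐ[μ] K := by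
    filter_upwards [hae] with x hx
    apply propext
    exact ⟨fun h => h.1, fun h => ⟨h, hx⟩⟩
  have hinj : InjOn F K0 := by
    intro x hx y hy h
    have := hA x hx.1 y hy.1
    rw [h, dist_self, mul_zero] at this
    exact dist_le_zero.1 this
  have hd : ∀ x ∈ K0, HasFDerivWithinAt F (fderiv ℝ F x) K0 x := fun x hx =>
    hx.2.hasFDerivAt.hasFDerivWithinAt
  have hemb := measurableEmbedding_of_fderivWithin hK0m hd hinj
  have hsign : Measurable Real.sign := by
    unfold Real.sign
    exact Measurable.ite measurableSet_Iio measurable_const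
      (Measurable.ite measurableSet_Ioi measurable_const measurable_const)
  let σ : E → ℝ := Function.extend (K0.domRestrict F)
    (fun x : K0 => Real.sign ((fderiv ℝ F x).det)) 0
  have hσm : Measurable σ := hemb.measurable_extend
    ((hsign.comp (BF.measurable_det_fderiv F)).comp measurable_subtype_coe) measurable_const
  have hσF : ∀ x ∈ K0, σ (F x) = Real.sign ((fderiv ℝ F x).det) := fun x hx =>
    hemb.injective.extend_apply (fun x : K0 => Real.sign ((fderiv ℝ F x).det)) 0 ⟨x, hx⟩
  have hσ0' : ∀ z, z ∉ F '' K0 → σ z = 0 := by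
    intro z hz
    refine Function.extend_apply' _ _ _ ?_
    rintro ⟨⟨x, hx⟩, rfl⟩
    exact hz ⟨x, hx, rfl⟩
  have hs1 : ∀ r : ℝ, ‖Real.sign r‖ ≤ 1 := by
    intro r
    rcases Real.sign_apply_eq r with h | h | h <;> rw [h] <;> simp
  have hσb : ∀ z, ‖σ z‖ ≤ 1 := by
    intro z
    by_cases hz : z ∈ F '' K0
    · obtain ⟨x, hx, rfl⟩ := hz
      rw [hσF x hx]; exact hs1 _
    · rw [hσ0' z hz]; simp
  have himg : MeasurableSet (F '' K0) := by
    have := hemb.measurableSet_range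
    rwa [Set.range_domRestrict] at this
  have hform : ∀ g : E → ℝ, ∫ z, σ z * g z ∂μ = ∫ x in K0, (fderiv ℝ F x).det * g (F x) ∂μ := by
    intro g
    rw [← setIntegral_eq_integral_of_forall_compl_eq_zero (s := F '' K0)
      (fun z hz => by rw [hσ0' z hz, zero_mul]),
      integral_image_eq_integral_abs_det_fderiv_smul μ hK0m hd hinj]
    refine setIntegral_congr_fun hK0m fun x hx => ?_
    simp only [smul_eq_mul]
    rw [hσF x hx, ← mul_assoc]
    congr 1
    rcases lt_trichotomy ((fderiv ℝ F x).det) 0 with h | h | h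
    · rw [Real.sign_of_neg h, abs_of_neg h]; ring
    · rw [h]; simp
    · rw [Real.sign_of_pos h, abs_of_pos h]; ring
  refine ⟨σ, ?_, ?_, ?_, ?_⟩
  · rw [locallyIntegrable_iff]
    intro k hk
    exact Measure.integrableOn_of_bounded (M := 1) hk.measure_lt_top.ne
      hσm.aestronglyMeasurable (Eventually.of_forall hσb)
  · exact fun z hz => hσ0' z fun h => hz (image_mono inter_subset_left h)
  · intro g
    rw [hform g]
    exact setIntegral_congr_set hKae
  · intro h0
    have h1 : ∀ᵐ x ∂(μ.restrict K0), (fderiv ℝ F x).det = 0 := by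
      have h2 : ∫⁻ x in K0, ENNReal.ofReal |(fderiv ℝ F x).det| ∂μ = 0 := by
        have h3 := lintegral_image_eq_lintegral_abs_det_fderiv_mul μ hK0m hd hinj
          (fun z => ENNReal.ofReal |σ z|)
        have h4 : ∫⁻ z in F '' K0, ENNReal.ofReal |σ z| ∂μ = 0 := by
          rw [lintegral_eq_zero_iff (hσm.abs.ennreal_ofReal)]
          filter_upwards [ae_restrict_of_ae h0] with z hz
          simp [hz]
        rw [h4] at h3
        rw [h3]
        refine setLIntegral_congr_fun hK0m fun x hx => ?_
        rw [hσF x hx, ← ENNReal.ofReal_mul (abs_nonneg _), ← abs_mul]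
        congr 1
        rcases lt_trichotomy ((fderiv ℝ F x).det) 0 with h | h | h
        · rw [Real.sign_of_neg h, abs_mul]; simp
        · rw [h]; simp
        · rw [Real.sign_of_pos h, abs_mul]; simp
      rw [lintegral_eq_zero_iff] at h2
      · filter_upwards [h2] with x hx
        simpa using hx
      · exact ((BF.measurable_det_fderiv F).abs).ennreal_ofReal
    have h3 : μ (F '' K0) = 0 := by
      rw [← lintegral_abs_det_fderiv_eq_addHaar_image μ hK0m hd hinj]
      rw [lintegral_eq_zero_iff ((BF.measurable_det_fderiv F).abs).ennreal_ofReal]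
      filter_upwards [h1] with x hx
      simp [hx]
    have h4 : LipschitzOnWith A (Function.invFunOn F K0) (F '' K0) := by
      apply LipschitzOnWith.of_dist_le_mul
      rintro _ ⟨x, hx, rfl⟩ _ ⟨y, hy, rfl⟩
      rw [hinj.leftInvOn_invFunOn hx, hinj.leftInvOn_invFunOn hy]
      exact hA x hx.1 y hy.1
    have h5 := BF.null_image μ h4 h3
    rw [hinj.leftInvOn_invFunOn.image_image] at h5
    rw [← measure_congr hKae]; exact h5

theorem BF.det_comp_transvection (A : E →L[ℝ] E) (l : E →L[ℝ] ℝ) (h : E) :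
    (A + (l.comp A).smulRight h).det = A.det * (1 + l h) := by
  have : ((A + (l.comp A).smulRight h : E →L[ℝ] E) : E →ₗ[ℝ] E)
      = (LinearMap.transvection (l : E →ₗ[ℝ] ℝ) h) ∘ₗ (A : E →ₗ[ℝ] E) := by
    ext x
    simp [LinearMap.transvection.apply]
  change LinearMap.det _ = LinearMap.det _ * _
  rw [this, LinearMap.det_comp, LinearMap.transvection.det]
  simp [mul_comm]

/-- Stationarity of the signed area under variation in direction `h`. -/
theorem BF.deriv_zero [Nontrivial E] {C D : ℝ≥0} {F : E → E} (hF : LipschitzWith C F) {K : Set E}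
    (hK : MeasurableSet K) {cut : E → ℝ} (hcut : LipschitzWith D cut)
    (hcutc : HasCompactSupport cut) (h : E) (Ψ : E → ℝ)
    (h0 : ∀ᵐ x ∂μ, x ∉ K → (fderiv ℝ F x).det = 0)
    (h1 : ∀ᵐ x ∂μ, x ∉ K → (fderiv ℝ (fun x => F x + cut x • h) x).det = 0)
    (h2 : ∀ᵐ x ∂μ, x ∈ K → fderiv ℝ cut x = (fderiv ℝ Ψ (F x)).comp (fderiv ℝ F x)) :
    ∫ x in K, (fderiv ℝ F x).det * fderiv ℝ Ψ (F x) h ∂μ = 0 := by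
  have hc : LipschitzWith (D * ‖h‖₊) (fun x => cut x • h) := by
    apply LipschitzWith.of_dist_le_mul
    intro x y
    rw [dist_eq_norm, ← sub_smul, norm_smul]
    have := hcut.dist_le_mul x y
    rw [dist_eq_norm] at this
    push_cast
    nlinarith [norm_nonneg h]
  have hs := BF.integral_det_sub_eq_zero μ hF (hF.add hc) (by
    simp only [add_sub_cancel_left]
    exact hcutc.smul_right)
  rw [← integral_indicator hK, ← hs]
  apply integral_congr_ae
  filter_upwards [h0, h1, h2, hF.ae_differentiableAt, hcut.ae_differentiableAt] with x h0 h1 h2 h3 h4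
  by_cases hx : x ∈ K
  · rw [indicator_of_mem hx]
    have h5 : fderiv ℝ (fun x => F x + cut x • h) x
        = fderiv ℝ F x + ((fderiv ℝ Ψ (F x)).comp (fderiv ℝ F x)).smulRight h := by
      rw [← h2 hx]
      exact (h3.hasFDerivAt.add (h4.hasFDerivAt.smul_const h)).fderiv
    rw [h5, BF.det_comp_transvection]; ring
  · rw [indicator_of_notMem hx, h0 hx, h1 hx, sub_self]
end sigma

section core

theorem BF.lip_mul {X : Type*} [PseudoMetricSpace X] {a b : X → ℝ} {C D : ℝ≥0} {M N : ℝ}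
    (ha : LipschitzWith C a) (hb : LipschitzWith D b) (hM : ∀ x, |a x| ≤ M) (hN : ∀ x, |b x| ≤ N) :
    ∃ K : ℝ≥0, LipschitzWith K fun x => a x * b x := by
  refine ⟨Real.toNNReal (M * D + N * C), LipschitzWith.of_dist_le_mul fun x y => ?_⟩
  have h1 := ha.dist_le_mul x y
  have h2 := hb.dist_le_mul x y
  have hM0 : 0 ≤ M := (abs_nonneg _).trans (hM x)
  have hN0 : 0 ≤ N := (abs_nonneg _).trans (hN x)
  rw [Real.coe_toNNReal _ (by positivity)]
  rw [Real.dist_eq] at *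
  have : a x * b x - a y * b y = a x * (b x - b y) + b y * (a x - a y) := by ring
  rw [this]
  refine (abs_add_le _ _).trans ?_
  rw [abs_mul, abs_mul]
  have h3 : |a x| * |b x - b y| ≤ M * (D * dist x y) :=
    mul_le_mul (hM x) h2 (abs_nonneg _) hM0
  have h4 : |b y| * |a x - a y| ≤ N * (C * dist x y) :=
    mul_le_mul (hN y) h1 (abs_nonneg _) hN0
  linarith

theorem BF.conv_zero {E : Type*} [NormedAddCommGroup E] [NormedSpace ℝ E] [FiniteDimensional ℝ E]
    [MeasurableSpace E] [BorelSpace E] (μ : Measure E) [μ.IsAddHaarMeasure]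
    {σ : E → ℝ} (φ : ContDiffBump (0 : E)) (x : E) (h : ∀ t, dist t x < φ.rOut → σ t = 0) :
    (φ.normed μ ⋆[ContinuousLinearMap.lsmul ℝ ℝ, μ] σ) x = 0 := by
  unfold convolution
  rw [← integral_zero E ℝ (μ := μ)]
  congr 1
  ext t
  by_cases ht : t ∈ ball (0 : E) φ.rOut
  · rw [h (x - t) (by simpa [dist_eq_norm] using ht)]; simp
  · have : t ∉ Function.support (φ.normed μ) := by rwa [φ.support_normed_eq]
    rw [Function.notMem_support.1 this]; simp

variable {T : Type} [MetricSpace T] {V : Type*} [NormedAddCommGroup V] [NormedSpace ℝ V]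
  [FiniteDimensional ℝ V] [MeasurableSpace V] [BorelSpace V] [SecondCountableTopology V]

/-- Projection of `f` to the strip `[c,d] × V`. -/
noncomputable def BF.F (c d : T) (f : ℝ × V → T × V) (x : ℝ × V) : ℝ × V :=
  (BF.th c d (f x).1, (f x).2)

/-- Preimage of the strip `[c,d] × V`. -/
def BF.K (c d : T) (f : ℝ × V → T × V) : Set (ℝ × V) := {x | BF.ex c d (f x).1 = 0}

variable {f : ℝ × V → T × V} {C A : ℝ≥0}

theorem BF.K_closed (c d : T) (hf : LipschitzWith C f) : IsClosed (BF.K c d f) :=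
  isClosed_eq ((BF.ex_continuous c d).comp (continuous_fst.comp hf.continuous)) continuous_const

theorem BF.F_lip (c d : T) (hf : LipschitzWith C f) : LipschitzWith C (BF.F c d f) := by
  apply LipschitzWith.of_dist_le_mul
  intro x y
  refine le_trans ?_ (hf.dist_le_mul x y)
  rw [Prod.dist_eq, Prod.dist_eq]
  refine max_le_max ?_ le_rfl
  have := (BF.th_lip c d).dist_le_mul (f x).1 (f y).1
  simpa [BF.F] using this

theorem BF.F_anti (hT : IsRTree T) (c d : T) (ha : AntilipschitzWith A f) :
    ∀ x ∈ BF.K c d f, ∀ y ∈ BF.K c d f, dist x y ≤ A * dist (BF.F c d f x) (BF.F c d f y) := by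
  intro x hx y hy
  refine (ha.le_mul_dist x y).trans ?_
  gcongr
  rw [Prod.dist_eq, Prod.dist_eq]
  refine max_le_max ?_ le_rfl
  rw [← BF.th_isom hT hx hy]; exact le_of_eq (Real.dist_eq _ _).symm

theorem BF.th_ev (hT : IsRTree T) (c d : T) (hf : LipschitzWith C f) {x : ℝ × V}
    (hx : x ∉ BF.K c d f) : ∀ᶠ y in 𝓝 x, BF.th c d (f y).1 = BF.th c d (f x).1 := by
  have h' : 0 < BF.ex c d (f x).1 := (BF.ex_nonneg c d _).lt_of_ne fun h => hx h.symm
  have hc := hf.continuous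
  have : ∀ᶠ y in 𝓝 x, dist (f x).1 (f y).1 < BF.ex c d (f x).1 / 2 := by
    have h2 : Continuous fun y => dist (f x).1 (f y).1 := by fun_prop
    apply (isOpen_lt h2 continuous_const).mem_nhds
    simp only [mem_ofPred_eq, dist_self]; linarith
  filter_upwards [this] with y hy
  exact BF.th_const hT hy

theorem BF.det_fst {G : ℝ × V → ℝ × V} {x : ℝ × V} (h : ∀ᶠ y in 𝓝 x, (G y).1 = (G x).1) :
    (fderiv ℝ G x).det = 0 := by
  by_cases hd : DifferentiableAt ℝ G x
  · by_contra hne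
    have h1 : HasFDerivAt (fun y => (G y).1) ((ContinuousLinearMap.fst ℝ ℝ V).comp (fderiv ℝ G x)) x :=
      (ContinuousLinearMap.fst ℝ ℝ V).hasFDerivAt.comp x hd.hasFDerivAt
    have h2 : HasFDerivAt (fun y => (G y).1) (0 : ℝ × V →L[ℝ] ℝ) x :=
      (hasFDerivAt_const (G x).1 x).congr_of_eventuallyEq h
    have h3 := h1.unique h2
    have hu : IsUnit (LinearMap.det (fderiv ℝ G x : ℝ × V →ₗ[ℝ] ℝ × V)) := isUnit_iff_ne_zero.2 hne
    obtain ⟨y, hy⟩ := (LinearMap.equivOfDetNeZero _ hne).surjective ((1 : ℝ), (0 : V))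
    have h4 := congrArg (fun L => L y) h3
    have h5 : fderiv ℝ G x y = ((1 : ℝ), (0 : V)) := hy
    simp [h5] at h4
  · rw [fderiv_zero_of_not_differentiableAt hd, BF.det_zero]

theorem BF.compact_supp (ha : AntilipschitzWith A f) {cut : ℝ × V → ℝ} {B : Set T} {B' : Set V}
    (hB : Bornology.IsBounded B) (hB' : Bornology.IsBounded B')
    (h : ∀ x, cut x ≠ 0 → (f x).1 ∈ B ∧ (f x).2 ∈ B') : HasCompactSupport cut := by
  have h1 : Bornology.IsBounded (f ⁻¹' (B ×ˢ B')) := ha.isBounded_preimage (hB.prod hB')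
  have h2 : Bornology.IsBounded (Function.support cut) := h1.subset fun x hx => h x hx
  exact h2.isCompact_closure

variable (μ : Measure (ℝ × V)) [μ.IsAddHaarMeasure]

theorem BF.vert (hT : IsRTree T) (c d : T) (hf : LipschitzWith C f) (ha : AntilipschitzWith A f)
    (h : V) {Ψ : ℝ × V → ℝ} (hΨ : ContDiff ℝ 1 Ψ) (hΨc : HasCompactSupport Ψ) :
    ∫ x in BF.K c d f, (fderiv ℝ (BF.F c d f) x).det * fderiv ℝ Ψ (BF.F c d f x) (0, h) ∂μ = 0 := by
  obtain ⟨D, hD⟩ := ContDiff.lipschitzWith_of_hasCompactSupport (𝕂 := ℝ) hΨc hΨ one_ne_zero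
  obtain ⟨N, hN⟩ := hΨc.exists_bound_of_continuous hΨ.continuous
  have hF := BF.F_lip c d hf
  let χ : ℝ × V → ℝ := fun x => max (1 - BF.ex c d (f x).1) 0
  have hχ : LipschitzWith (2 * C) χ := by
    have h1 : LipschitzWith (2 * C) fun x => BF.ex c d (f x).1 :=
      (BF.ex_lip c d).comp (LipschitzWith.of_dist_le_mul fun x y =>
        le_trans (le_max_left _ _) (hf.dist_le_mul x y))
    have h2 : LipschitzWith (2 * C) fun x => 1 - BF.ex c d (f x).1 :=
      LipschitzWith.of_dist_le_mul fun x y => by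
        rw [dist_sub_left]; exact h1.dist_le_mul x y
    exact h2.max_const 0
  have hχ1 : ∀ x, χ x ≤ 1 := fun x => max_le (by linarith [BF.ex_nonneg c d (f x).1]) zero_le_one
  have hχ0 : ∀ x, 0 ≤ χ x := fun x => le_max_right _ _
  obtain ⟨L, hL⟩ := BF.lip_mul (M := 1) (N := N) hχ (hD.comp hF)
    (fun x => by rw [abs_of_nonneg (hχ0 x)]; exact hχ1 x) (fun x => hN _)
  refine BF.deriv_zero μ hF (BF.K_closed c d hf).measurableSet hL ?_ (0, h) Ψ ?_ ?_ ?_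
  · refine BF.compact_supp ha (B := ball c (1 + dist c d)) (B' := Prod.snd '' tsupport Ψ)
      isBounded_ball (hΨc.isCompact.image continuous_snd).isBounded ?_
    intro x hx
    have h1 : χ x ≠ 0 := left_ne_zero_of_mul hx
    have h2 : Ψ (BF.F c d f x) ≠ 0 := right_ne_zero_of_mul hx
    refine ⟨?_, BF.F c d f x, subset_tsupport _ h2, rfl⟩
    rw [mem_ball, dist_comm]
    by_contra hh
    apply h1
    refine max_eq_right ?_
    have := dist_nonneg (x := (f x).1) (y := d)
    unfold BF.ex; linarith
  · exact Eventually.of_forall fun x hx => BF.det_fst (BF.th_ev hT c d hf hx)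
  · refine Eventually.of_forall fun x hx => BF.det_fst ?_
    simpa [BF.F] using (BF.th_ev hT c d hf hx)
  · filter_upwards [hF.ae_differentiableAt, hχ.ae_differentiableAt] with x h1 h2 hx
    have hxx : χ x = 1 := by
      change max (1 - BF.ex c d (f x).1) 0 = 1
      rw [show BF.ex c d (f x).1 = 0 from hx]; simp
    have h3 : fderiv ℝ χ x = 0 := IsLocalMax.fderiv_eq_zero
      (Eventually.of_forall fun y => by rw [hxx]; exact hχ1 y)
    have h4 := (hΨ.differentiable one_ne_zero (BF.F c d f x)).hasFDerivAt.comp x h1.hasFDerivAt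
    have h5 := (h2.hasFDerivAt.mul h4).fderiv
    rw [h3, hxx] at h5
    simp only [smul_zero, add_zero, one_smul] at h5
    exact h5

theorem BF.horiz (hT : IsRTree T) (c d : T) (hf : LipschitzWith C f) (ha : AntilipschitzWith A f)
    (hb : Bornology.IsBounded {t | (∃ x, (f x).1 = t) ∧ 0 < BF.th c d t})
    (h : ℝ × V) {Ψ : ℝ × V → ℝ} (hΨ : ContDiff ℝ 1 Ψ) (hΨc : HasCompactSupport Ψ)
    (hΨ0 : ∀ z : ℝ × V, z.1 ≤ 0 → Ψ z = 0) :
    ∫ x in BF.K c d f, (fderiv ℝ (BF.F c d f) x).det * fderiv ℝ Ψ (BF.F c d f x) h ∂μ = 0 := by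
  obtain ⟨D, hD⟩ := ContDiff.lipschitzWith_of_hasCompactSupport (𝕂 := ℝ) hΨc hΨ one_ne_zero
  have hF := BF.F_lip c d hf
  have hder : ∀ x, DifferentiableAt ℝ (BF.F c d f) x →
      HasFDerivAt (Ψ ∘ BF.F c d f) ((fderiv ℝ Ψ (BF.F c d f x)).comp (fderiv ℝ (BF.F c d f) x)) x :=
    fun x h1 => (hΨ.differentiable one_ne_zero (BF.F c d f x)).hasFDerivAt.comp x h1.hasFDerivAt
  refine BF.deriv_zero μ hF (BF.K_closed c d hf).measurableSet (hD.comp hF) ?_ h Ψ ?_ ?_ ?_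
  · refine BF.compact_supp ha hb (hΨc.isCompact.image continuous_snd).isBounded ?_
    intro x hx
    have h2 : Ψ (BF.F c d f x) ≠ 0 := hx
    refine ⟨⟨⟨x, rfl⟩, ?_⟩, BF.F c d f x, subset_tsupport _ h2, rfl⟩
    by_contra hh
    exact h2 (hΨ0 _ (not_lt.1 hh))
  · exact Eventually.of_forall fun x hx => BF.det_fst (BF.th_ev hT c d hf hx)
  · filter_upwards [hF.ae_differentiableAt] with x h1 hx
    have h2 : fderiv ℝ (fun x => BF.F c d f x + (Ψ ∘ BF.F c d f) x • h) x = _ :=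
      (h1.hasFDerivAt.add ((hder x h1).smul_const h)).fderiv
    rw [h2, BF.det_comp_transvection, BF.det_fst (BF.th_ev hT c d hf hx), zero_mul]
  · filter_upwards [hF.ae_differentiableAt] with x h1 hx
    exact (hder x h1).fderiv

/-- Every vertical line is approached by the strip. -/
theorem BF.vert_dense (hT : IsRTree T) (c d : T) (hf : LipschitzWith C f)
    (ha : AntilipschitzWith A f) (hK : μ (BF.K c d f) ≠ 0) (w : V) {ε : ℝ} (hε : 0 < ε) :
    ∃ x ∈ BF.K c d f, dist (f x).2 w < ε := by
  by_contra! hn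
  obtain ⟨σ, hσ, hσ0, hσi, hσK⟩ := BF.sigma μ (BF.F_lip c d hf) (BF.K_closed c d hf).measurableSet
    (BF.F_anti hT c d ha)
  apply hK
  apply hσK
  have hz : ∀ z : ℝ × V, dist z.2 w < ε → σ z = 0 := by
    intro z hz
    apply hσ0
    rintro ⟨x, hx, rfl⟩
    exact absurd hz (not_lt.2 (hn x hx))
  filter_upwards [BF.ae_conv μ hσ] with z hzt
  refine tendsto_nhds_unique hzt (tendsto_const_nhds.congr' ?_)
  filter_upwards [(BF.bump_tendsto (E := ℝ × V)).eventually_lt_const hε] with k hk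
  rw [BF.conv_const μ hσ (BF.bump k) z (z.1, w), BF.conv_zero]
  · rfl
  · intro t ht
    apply hz
    exact lt_of_le_of_lt (le_max_right _ _) (ht.trans hk)
  · intro Ψ hΨ hΨc _
    rw [hσi]
    have : (z.1, w) - z = ((0 : ℝ), w - z.2) := by ext <;> simp
    rw [this]
    exact BF.vert μ hT c d hf ha _ hΨ hΨc

/-- The part of the image beyond `c` towards `d` is unbounded. -/
theorem BF.flow (hT : IsRTree T) (c d : T) (hf : LipschitzWith C f)
    (ha : AntilipschitzWith A f) (hK : μ (BF.K c d f) ≠ 0) :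
    ¬ Bornology.IsBounded {t | (∃ x, (f x).1 = t) ∧ 0 < BF.th c d t} := by
  intro hb
  obtain ⟨σ, hσ, hσ0, hσi, hσK⟩ := BF.sigma μ (BF.F_lip c d hf) (BF.K_closed c d hf).measurableSet
    (BF.F_anti hT c d ha)
  apply hK
  apply hσK
  have hnull : ∀ᵐ z ∂μ, z.1 ≠ 0 := by
    have h1 : LinearMap.ker (LinearMap.fst ℝ ℝ V) ≠ ⊤ := by
      intro h
      have : ((1 : ℝ), (0 : V)) ∈ LinearMap.ker (LinearMap.fst ℝ ℝ V) := h ▸ Submodule.mem_top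
      simp at this
    have h2 := Measure.addHaar_submodule μ _ h1
    rw [ae_iff]
    convert h2 using 2
    ext z; simp
  filter_upwards [BF.ae_conv μ hσ, hnull] with z hzt hz0
  rcases lt_or_gt_of_ne hz0 with hneg | hpos
  · apply hσ0
    rintro ⟨x, hx, rfl⟩
    exact absurd hneg (not_lt.2 (BF.th_nonneg _ _ _))
  refine tendsto_nhds_unique hzt (tendsto_const_nhds.congr' ?_)
  filter_upwards [(BF.bump_tendsto (E := ℝ × V)).eventually_lt_const hpos] with k hk
  have hr : 0 < dist c d + 1 := by positivity
  rw [BF.conv_const μ hσ (BF.bump k) z (z.1 + (dist c d + 1), z.2), BF.conv_zero]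
  · rfl
  · intro t ht
    apply hσ0
    rintro ⟨x, hx, rfl⟩
    have h1 := lt_of_le_of_lt (le_max_left _ _) (ht.trans hk)
    rw [Real.dist_eq] at h1
    have h2 := (abs_lt.1 h1).1
    have h3 : (BF.F c d f x).1 ≤ dist c d := BF.th_le _ _ _
    simp only at h2
    linarith
  · rintro Ψ hΨ hΨc ⟨y, hy, hΨ0⟩
    rw [hσi]
    refine BF.horiz μ hT c d hf ha hb _ hΨ hΨc ?_
    intro t ht
    apply hΨ0
    intro htb
    have h1 := lt_of_le_of_lt (le_max_left _ _) (lt_trans htb hk)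
    rw [Real.dist_eq] at h1
    have h2 := (abs_lt.1 h1).1
    have h3 : z.1 ≤ y.1 := by
      obtain ⟨a, b, ha, hb, hab, rfl⟩ := hy
      simp only [Prod.fst_add, Prod.smul_fst, smul_eq_mul]
      nlinarith [mul_nonneg hb hr.le]
    linarith

end core

section line

variable {T : Type} [MetricSpace T] {V : Type*} [NormedAddCommGroup V] [NormedSpace ℝ V]
  [FiniteDimensional ℝ V] [MeasurableSpace V] [BorelSpace V] [SecondCountableTopology V]
variable {f : ℝ × V → T × V} {C A : ℝ≥0}

theorem BF.fst_lip (hf : LipschitzWith C f) : LipschitzWith C fun x => (f x).1 :=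
  LipschitzWith.of_dist_le_mul fun x y => le_trans (le_max_left _ _) (hf.dist_le_mul x y)

theorem BF.snd_lip (hf : LipschitzWith C f) : LipschitzWith C fun x => (f x).2 :=
  LipschitzWith.of_dist_le_mul fun x y => le_trans (le_max_right _ _) (hf.dist_le_mul x y)

theorem BF.K_pos (μ : Measure (ℝ × V)) [μ.IsAddHaarMeasure] (hT : IsRTree T)
    (hf : LipschitzWith C f) {x y : ℝ × V} (hxy : (f x).1 ≠ (f y).1) :
    μ (BF.K (f x).1 (f y).1 f) ≠ 0 := by
  intro h0
  set c := (f x).1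
  set d := (f y).1
  have h1 := BF.lip_const μ ((BF.th_lip c d).comp (BF.fst_lip hf)) (by
    have : ∀ᵐ z ∂μ, z ∉ BF.K c d f := by
      rw [ae_iff]; simpa using h0
    filter_upwards [this] with z hz
    exact ((hasFDerivAt_const (BF.th c d (f z).1) z).congr_of_eventuallyEq
      (BF.th_ev hT c d hf hz)).fderiv) x y
  change BF.th c d c = BF.th c d d at h1
  have : dist c d = 0 := by
    unfold BF.th at h1
    rw [dist_self, dist_self] at h1
    linarith
  exact hxy (dist_eq_zero.1 this)

theorem BF.not_const (ha : AntilipschitzWith A f) (x0 : ℝ × V) {r : ℝ}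
    (hr : 0 < r) : ∃ y ∈ ball x0 r, (f x0).1 ≠ (f y).1 := by
  by_contra! hn
  let μ : Measure (ℝ × V) := Measure.addHaar
  let G : ℝ × V → ℝ × V := fun x => (0, (f x).2)
  have hG : ∀ x ∈ ball x0 r, ∀ y ∈ ball x0 r, dist x y ≤ A * dist (G x) (G y) := by
    intro x hx y hy
    refine (ha.le_mul_dist x y).trans ?_
    gcongr
    rw [Prod.dist_eq, Prod.dist_eq, ← hn x hx, ← hn y hy]
    simp [G]
  have hinj : InjOn G (ball x0 r) := by
    intro x hx y hy h
    have := hG x hx y hy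
    rw [h, dist_self, mul_zero] at this
    exact dist_le_zero.1 this
  have h4 : LipschitzOnWith A (Function.invFunOn G (ball x0 r)) (G '' ball x0 r) := by
    apply LipschitzOnWith.of_dist_le_mul
    rintro _ ⟨x, hx, rfl⟩ _ ⟨y, hy, rfl⟩
    rw [hinj.leftInvOn_invFunOn hx, hinj.leftInvOn_invFunOn hy]
    exact hG x hx y hy
  have hnull : μ (G '' ball x0 r) = 0 := by
    have h1 : LinearMap.ker (LinearMap.fst ℝ ℝ V) ≠ ⊤ := by
      intro h
      have : ((1 : ℝ), (0 : V)) ∈ LinearMap.ker (LinearMap.fst ℝ ℝ V) := h ▸ Submodule.mem_top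
      simp at this
    refine measure_mono_null ?_ (Measure.addHaar_submodule μ _ h1)
    rintro _ ⟨x, _, rfl⟩
    simp [G]
  have h5 := BF.null_image μ h4 hnull
  rw [hinj.leftInvOn_invFunOn.image_image] at h5
  exact (measure_ball_pos μ x0 hr).ne' h5

theorem BF.prod_range (hT : IsRTree T) (hf : LipschitzWith C f) (ha : AntilipschitzWith A f)
    (x0 : ℝ × V) (w : V) : ∃ x, f x = ((f x0).1, w) := by
  have hcl : IsClosed (range f) := ha.isClosed_range hf.uniformContinuous
  change _ ∈ range f
  rw [← hcl.closure_eq, Metric.mem_closure_iff]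
  intro ε hε
  obtain ⟨y, hy, hne⟩ := BF.not_const ha x0 (r := ε / (C + 1)) (by positivity)
  have hd : dist (f x0).1 (f y).1 < ε := by
    refine lt_of_le_of_lt ((BF.fst_lip hf).dist_le_mul x0 y) ?_
    rw [mem_ball, dist_comm, lt_div_iff₀ (by positivity)] at hy
    nlinarith [dist_nonneg (x := x0) (y := y)]
  obtain ⟨x, hx, hxw⟩ := BF.vert_dense Measure.addHaar hT (f x0).1 (f y).1 hf ha
    (BF.K_pos _ hT hf hne) w hε
  refine ⟨f x, ⟨x, rfl⟩, ?_⟩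
  rw [Prod.dist_eq]
  refine max_lt ?_ (by rwa [dist_comm])
  have h1 : BF.ex (f x0).1 (f y).1 (f x).1 = 0 := hx
  unfold BF.ex at h1
  have := dist_nonneg (x := (f x).1) (y := (f y).1)
  change dist (f x0).1 (f x).1 < ε
  linarith

theorem BF.exists_far (hT : IsRTree T) (hf : LipschitzWith C f) (ha : AntilipschitzWith A f)
    {p d : T} (hp : p ∈ range fun x => (f x).1) (hd : d ∈ range fun x => (f x).1) (hne : p ≠ d)
    (k : ℝ) : ∃ t ∈ range fun x => (f x).1, 0 < BF.th p d t ∧ k ≤ dist p t := by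
  obtain ⟨x, rfl⟩ := hp
  obtain ⟨y, rfl⟩ := hd
  by_contra! hn
  refine BF.flow Measure.addHaar hT _ _ hf ha (BF.K_pos _ hT hf hne) ?_
  refine (isBounded_ball (x := (f x).1) (r := k)).subset ?_
  rintro t ⟨ht, ht'⟩
  rw [mem_ball, dist_comm]
  exact hn t ht ht'

theorem BF.line (hT : IsRTree T) (hf : LipschitzWith C f) (ha : AntilipschitzWith A f) :
    ∃ g : ℝ → T, Isometry g ∧ ∀ r w, (g r, w) ∈ range f := by
  obtain ⟨y, -, hne⟩ := BF.not_const ha (0 : ℝ × V) one_pos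
  set u : ℝ × V → T := fun x => (f x).1 with hu
  have huc : Continuous u := (BF.fst_lip hf).continuous
  set c := (f 0).1
  set d := (f y).1
  have hc : c ∈ range u := ⟨0, rfl⟩
  have hd : d ∈ range u := ⟨y, rfl⟩
  have hcd : 0 < dist c d := dist_pos.2 hne
  obtain ⟨γ, g0, g1, gi⟩ := hT.geodesic c d
  set p := γ (dist c d / 2)
  have hcp : dist c p = dist c d / 2 := by
    have := gi 0 ⟨le_rfl, hcd.le⟩ (dist c d / 2) ⟨by linarith, by linarith⟩
    rw [g0] at this
    rw [this, zero_sub, abs_neg, abs_of_pos (by linarith)]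
  have hpd : dist p d = dist c d / 2 := by
    have := gi (dist c d / 2) ⟨by linarith, by linarith⟩ (dist c d) ⟨hcd.le, le_rfl⟩
    rw [g1] at this
    rw [this, abs_of_neg (by linarith)]; linarith
  have hex : BF.ex c d p = 0 := by unfold BF.ex; linarith
  have hp : p ∈ range u := BF.range_convex hT huc hc hd hex
  have hpd' : p ≠ d := dist_pos.1 (by linarith)
  have hpc' : p ≠ c := dist_pos.1 (by rw [dist_comm]; linarith)
  have hk : ∀ k : ℕ, ∃ g : ℝ → T, g 0 = p ∧ (∀ r ∈ Icc (-k : ℝ) k, g r ∈ range u) ∧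
      ∀ r ∈ Icc (-k : ℝ) k, ∀ s ∈ Icc (-k : ℝ) k, dist (g r) (g s) = |r - s| := by
    intro k
    obtain ⟨t, ht, ht0, htk⟩ := BF.exists_far hT hf ha hp hd hpd' k
    obtain ⟨t', ht', ht0', htk'⟩ := BF.exists_far hT hf ha hp hc hpc' k
    have h1 := BF.opposite hT hex ht0 ht0'
    obtain ⟨g, h2, h3, h4⟩ := BF.path hT h1 (by rwa [dist_comm]) htk
    exact ⟨g, h2, fun r hr => BF.range_convex hT huc ht' ht (h3 r hr), h4⟩
  choose g hg0 hgr hgi using hk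
  have hz : ∀ (k : ℕ) (r : ℝ), ∃ z : ℝ × V, r ∈ Icc (-k : ℝ) k → f z = (g k r, 0) := by
    intro k r
    by_cases hr : r ∈ Icc (-k : ℝ) k
    · obtain ⟨x, hx⟩ := hgr k r hr
      obtain ⟨z, hz⟩ := BF.prod_range hT hf ha x 0
      refine ⟨z, fun _ => ?_⟩
      rw [hz]; exact congrArg (fun t => (t, (0 : V))) hx
    · exact ⟨0, fun h => absurd h hr⟩
  choose z hz using hz
  have hz0 : ∀ k, z k 0 = z 0 0 := by
    intro k
    apply ha.injective
    rw [hz k 0 (by simp), hz 0 0 (by simp), hg0, hg0]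
  have hev : ∀ r : ℝ, ∀ᶠ k : ℕ in hyperfilter ℕ, r ∈ Icc (-k : ℝ) k := by
    intro r
    have h1 : ∀ᶠ k : ℕ in atTop, |r| ≤ (k : ℝ) :=
      tendsto_natCast_atTop_atTop.eventually_ge_atTop |r|
    rw [← Nat.cofinite_eq_atTop] at h1
    filter_upwards [hyperfilter_le_cofinite h1] with k hk
    exact abs_le.1 hk
  have hlim : ∀ r : ℝ, ∃ Z, Tendsto (fun k => z k r) (hyperfilter ℕ) (𝓝 Z) := by
    intro r
    have hcomp : IsCompact (closedBall (z 0 0) (A * |r|)) := isCompact_closedBall _ _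
    obtain ⟨Z, -, hZ⟩ := hcomp.ultrafilter_le_nhds' ((hyperfilter ℕ).map fun k => z k r) (by
      change ∀ᶠ k in hyperfilter ℕ, z k r ∈ closedBall (z 0 0) (A * |r|)
      filter_upwards [hev r] with k hk
      rw [mem_closedBall, ← hz0 k]
      refine (ha.le_mul_dist _ _).trans ?_
      have h0 : (0 : ℝ) ∈ Icc (-k : ℝ) k := by simp
      rw [hz k r hk, hz k 0 h0, Prod.dist_eq]
      simp [hgi k r hk 0 h0])
    exact ⟨Z, hZ⟩
  choose Z hZ using hlim
  refine ⟨fun r => u (Z r), ?_, ?_⟩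
  · refine Isometry.of_dist_eq fun r s => ?_
    have h1 : Tendsto (fun k => dist (u (z k r)) (u (z k s))) (hyperfilter ℕ)
        (𝓝 (dist (u (Z r)) (u (Z s)))) :=
      ((huc.tendsto _).comp (hZ r)).dist ((huc.tendsto _).comp (hZ s))
    refine tendsto_nhds_unique h1 (tendsto_const_nhds.congr' ?_)
    filter_upwards [hev r, hev s] with k hr hs
    simp only [hu]
    rw [hz k r hr, hz k s hs, Real.dist_eq]
    exact (hgi k r hr s hs).symm
  · intro r w
    exact BF.prod_range hT hf ha (Z r) w

theorem BF.real_surj {g : ℝ → ℝ} (hg : Isometry g) : Function.Surjective g := by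
  intro y
  have h1 := hg.dist_eq (y - g 0) 0
  have h2 := hg.dist_eq (-(y - g 0)) 0
  have h3 := hg.dist_eq (y - g 0) (-(y - g 0))
  simp only [Real.dist_eq, sub_zero, abs_neg] at h1 h2 h3
  rcases abs_eq_abs.1 h1 with h | h
  · exact ⟨y - g 0, by linarith⟩
  rcases abs_eq_abs.1 h2 with h' | h'
  · exact ⟨-(y - g 0), by linarith⟩
  · have : y - g 0 = 0 := by
      have e : g (y - g 0) - g (-(y - g 0)) = 0 := by linarith
      rw [e, abs_zero] at h3
      have := abs_eq_zero.1 h3.symm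
      linarith
    exact ⟨0, by linarith⟩

/-- Main result for the sup metric on the products. -/
theorem BF.main (hT : IsRTree T) (hf : LipschitzWith C f) (ha : AntilipschitzWith A f) :
    ∃ g : ℝ → T, Isometry g ∧ range f = {p | p.1 ∈ range g} := by
  obtain ⟨g, hg, hgf⟩ := BF.line hT hf ha
  refine ⟨g, hg, ?_⟩
  choose h hh using fun z : ℝ × V => hgf z.1 z.2
  have hd : ∀ z z', dist (f (h z)) (f (h z')) = dist z z' := by
    intro z z'
    rw [hh, hh, Prod.dist_eq, Prod.dist_eq]
    simp [hg.dist_eq]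
  have hl : LipschitzWith A h := LipschitzWith.of_dist_le_mul fun z z' => by
    rw [← hd z z']; exact ha.le_mul_dist _ _
  have hal : AntilipschitzWith C h := AntilipschitzWith.of_le_mul_dist fun z z' => by
    rw [← hd z z']; exact hf.dist_le_mul _ _
  obtain ⟨g', hg', hgh⟩ := BF.line BF.real_tree hl hal
  apply Subset.antisymm
  · rintro _ ⟨x, rfl⟩
    obtain ⟨r, hr⟩ := BF.real_surj hg' x.1
    obtain ⟨z, hz⟩ := hgh r x.2
    have hx : h z = x := by rw [hz, hr]
    rw [← hx, hh]
    exact ⟨z.1, rfl⟩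
  · rintro ⟨_, w⟩ ⟨r, rfl⟩
    exact hgf r w
end line

section final

theorem BF.mink {a b a' b' D1 D2 : ℝ} (ha : 0 ≤ a) (hb : 0 ≤ b) (ha' : 0 ≤ a') (hb' : 0 ≤ b')
    (h1 : D1 ≤ a + a') (h2 : D2 ≤ b + b') (hD1 : 0 ≤ D1) (hD2 : 0 ≤ D2)
    (h : √(a ^ 2 + b ^ 2) + √(a' ^ 2 + b' ^ 2) = √(D1 ^ 2 + D2 ^ 2)) : a + a' - D1 = 0 := by
  set P := √(a ^ 2 + b ^ 2) with hP
  set Q := √(a' ^ 2 + b' ^ 2) with hQ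
  have hP2 : P ^ 2 = a ^ 2 + b ^ 2 := Real.sq_sqrt (by positivity)
  have hQ2 : Q ^ 2 = a' ^ 2 + b' ^ 2 := Real.sq_sqrt (by positivity)
  have hR2 : (P + Q) ^ 2 = D1 ^ 2 + D2 ^ 2 := by rw [h]; exact Real.sq_sqrt (by positivity)
  have hP0 : 0 ≤ P := Real.sqrt_nonneg _
  have hQ0 : 0 ≤ Q := Real.sqrt_nonneg _
  have hcs : a * a' + b * b' ≤ P * Q := by
    apply le_of_sq_le_sq _ (by positivity)
    rw [mul_pow, hP2, hQ2]
    nlinarith [sq_nonneg (a * b' - b * a')]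
  have h3 : D2 ^ 2 ≤ (b + b') ^ 2 := by gcongr
  have h4 : (a + a') ^ 2 ≤ D1 ^ 2 := by nlinarith
  have h5 : a + a' ≤ D1 := le_of_sq_le_sq h4 hD1
  linarith

theorem BF.dist2 {X Y : Type*} [MetricSpace X] [MetricSpace Y] (x y : WithLp 2 (X × Y)) :
    dist x y = √(dist x.fst y.fst ^ 2 + dist x.snd y.snd ^ 2) := by
  rw [WithLp.prod_dist_eq_add (by norm_num), Real.sqrt_eq_rpow]
  simp

theorem BF.final {T : Type} [MetricSpace T] (hT : IsRTree T) (n : ℕ)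
    (f : EuclideanSpace ℝ (Fin (n + 1)) → WithLp 2 (T × EuclideanSpace ℝ (Fin n)))
    (L : ℝ) (hL : 1 ≤ L)
    (hbi : ∀ x y, dist x y / L ≤ dist (f x) (f y) ∧ dist (f x) (f y) ≤ L * dist x y) :
    ∃ g : ℝ → T, Isometry g ∧
      Set.range f = {p : WithLp 2 (T × EuclideanSpace ℝ (Fin n)) |
        ((WithLp.equiv 2 (T × EuclideanSpace ℝ (Fin n))) p).1 ∈ Set.range g} := by
  let e : EuclideanSpace ℝ (Fin (n + 1)) ≃L[ℝ] ℝ × EuclideanSpace ℝ (Fin n) :=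
    ContinuousLinearEquiv.ofFinrankEq (by simp [add_comm])
  have hL0 : 0 < L := by linarith
  have hf : LipschitzWith (Real.toNNReal L) f := LipschitzWith.of_dist_le_mul fun x y => by
    rw [Real.coe_toNNReal _ hL0.le]; exact (hbi x y).2
  have ha : AntilipschitzWith (Real.toNNReal L) f := AntilipschitzWith.of_le_mul_dist fun x y => by
    rw [Real.coe_toNNReal _ hL0.le]
    have := (hbi x y).1
    rw [div_le_iff₀ hL0] at this
    linarith
  let f' : ℝ × EuclideanSpace ℝ (Fin n) → T × EuclideanSpace ℝ (Fin n) :=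
    fun x => WithLp.ofLp (f (e.symm x))
  have hf' := (WithLp.prod_lipschitzWith_ofLp 2 T (EuclideanSpace ℝ (Fin n))).comp
    (hf.comp e.symm.lipschitz)
  have ha' := (WithLp.prod_antilipschitzWith_ofLp 2 T (EuclideanSpace ℝ (Fin n))).comp
    (ha.comp e.symm.antilipschitz)
  obtain ⟨g, hg, hr⟩ := BF.main (f := f') hT hf' ha'
  refine ⟨g, hg, ?_⟩
  ext p
  have h1 : p ∈ range f ↔ WithLp.ofLp p ∈ range f' := by
    constructor
    · rintro ⟨x, rfl⟩
      exact ⟨e x, by simp [f']⟩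
    · rintro ⟨x, hx⟩
      exact ⟨e.symm x, WithLp.ofLp_injective 2 hx⟩
  rw [h1, hr]
  rfl

end final

end helpers

/-- if `T` is a metric tree and `f : ℝ^{n+1} → T × ℝⁿ` (product with the
ℓ² metric) is a bilipschitz embedding, then the image of `f` is a convex subset of
`T × ℝⁿ` isometric to `ℝ^{n+1}`; in particular it has the form
(geodesic line in `T`) × ℝⁿ. -/
theorem bilipschitz_flat_is_flat {T : Type} [MetricSpace T] (hT : IsRTree T) (n : ℕ)
    (f : EuclideanSpace ℝ (Fin (n + 1)) → WithLp 2 (T × EuclideanSpace ℝ (Fin n)))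
    (L : ℝ) (hL : 1 ≤ L)
    (hbi : ∀ x y, dist x y / L ≤ dist (f x) (f y) ∧ dist (f x) (f y) ≤ L * dist x y) :
    (∀ x y z : WithLp 2 (T × EuclideanSpace ℝ (Fin n)),
      x ∈ Set.range f → y ∈ Set.range f → dist x z + dist z y = dist x y →
      z ∈ Set.range f) ∧
    (∃ g : ℝ → T, Isometry g ∧
      Set.range f = {p : WithLp 2 (T × EuclideanSpace ℝ (Fin n)) |
        ((WithLp.equiv 2 (T × EuclideanSpace ℝ (Fin n))) p).1 ∈ Set.range g}) ∧
    Nonempty ((Set.range f) ≃ᵢ EuclideanSpace ℝ (Fin (n + 1))) := by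
  obtain ⟨g, hg, hr⟩ := BF.final hT n f L hL hbi
  have hmem : ∀ p, p ∈ Set.range f ↔ p.fst ∈ Set.range g := fun p => by rw [hr]; rfl
  refine ⟨?_, ⟨g, hg, hr⟩, ?_⟩
  · intro x y z hx hy h
    rw [hmem] at hx hy ⊢
    refine BF.range_convex hT hg.continuous hx hy ?_
    rw [BF.dist2, BF.dist2, BF.dist2] at h
    exact BF.mink dist_nonneg dist_nonneg dist_nonneg dist_nonneg (dist_triangle _ _ _)
      (dist_triangle _ _ _) dist_nonneg dist_nonneg h
  · let W := WithLp 2 (ℝ × EuclideanSpace ℝ (Fin n))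
    have hfr : Module.finrank ℝ W = n + 1 := by
      rw [(WithLp.linearEquiv 2 ℝ (ℝ × EuclideanSpace ℝ (Fin n))).finrank_eq]
      simp [add_comm]
    let e : W ≃ₗᵢ[ℝ] EuclideanSpace ℝ (Fin (n + 1)) :=
      ((stdOrthonormalBasis ℝ W).reindex (finCongr hfr)).repr
    let ψ : W → Set.range f := fun p =>
      ⟨WithLp.toLp 2 (g p.fst, p.snd), (hmem _).2 ⟨p.fst, rfl⟩⟩
    have hψ : Isometry ψ := by
      refine Isometry.of_dist_eq fun p q => ?_
      rw [Subtype.dist_eq, BF.dist2, BF.dist2]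
      simp [ψ, hg.dist_eq]
    have hs : Function.Surjective ψ := by
      rintro ⟨p, hp⟩
      obtain ⟨r, hr'⟩ := (hmem p).1 hp
      refine ⟨WithLp.toLp 2 (r, p.snd), Subtype.ext ?_⟩
      apply WithLp.ofLp_injective 2
      exact Prod.ext hr' rfl
    exact ⟨(IsometryEquiv.mk (Equiv.ofBijective ψ ⟨hψ.injective, hs⟩) hψ).symm.trans
      e.toIsometryEquiv⟩
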